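/- arXiv:2206.11780 — 2 statements merged into one kernel-verified Lean document; each statement's English description precedes it below -/
import Mathlib

section
/- (Consistency of Interp.) Let X be a real normed vector space, T a positive integer, x_0 ∈ X, and f_1, …, f_T : X → ℝ convex functions with f_t ≥ 0 everywhere. Let x̃_0 = x_0, x̃_1, …, x̃_T and s_0 = x_0, s_1, …, s_T be arbitrary sequences in X, let γ > 0 and δ > 0, set ε = 2γ + 2δ, and let μ ≥ 1 be a real number that is simultaneously a rectangular bound for X and a radial Lipschitz bound for X. Let x_0, x_1, …, x_T be the Interp sequence determined by these data. Then C_x(1, T) ≤ (μ + ε)·C_x̃(1, T). -/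
/-- The radial retraction onto the closed ball of radius `r`. -/
noncomputable def radial {X : Type*} [NormedAddCommGroup X] [NormedSpace ℝ X]
    (v : X) (r : ℝ) : X :=
  if ‖v‖ ≤ r then v else (r / ‖v‖) • v

/-- `u` is Birkhoff-James orthogonal to `v`. -/
def BJOrth {X : Type*} [NormedAddCommGroup X] [NormedSpace ℝ X] (u v : X) : Prop :=
  ∀ l : ℝ, ‖u‖ ≤ ‖u + l • v‖

/-- `μ` is a rectangular bound for `X`. -/
def RectBound (X : Type*) [NormedAddCommGroup X] [NormedSpace ℝ X] (μ : ℝ) : Prop :=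
  ∀ u v : X, BJOrth u v → ‖u‖ + ‖v‖ ≤ μ * ‖u + v‖

/-- `k` is a radial Lipschitz bound for `X`. -/
def RadialLipBound (X : Type*) [NormedAddCommGroup X] [NormedSpace ℝ X] (k : ℝ) : Prop :=
  ∀ u v : X, ∀ r : ℝ, 0 < r → ‖radial u r - radial v r‖ ≤ k * ‖u - v‖

/-- The cost of the sequence `z` over times `a` through `b`:
`C_z(a, b) = Σ_{t=a}^{b} (f_t(z_t) + ‖z_t − z_{t−1}‖)`. -/
noncomputable def cost {X : Type*} [NormedAddCommGroup X]
    (f : ℕ → X → ℝ) (z : ℕ → X) (a b : ℕ) : ℝ :=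
  ∑ t ∈ Finset.Icc a b, (f t (z t) + ‖z t - z (t - 1)‖)

section Radial

variable {X : Type*} [NormedAddCommGroup X] [NormedSpace ℝ X]

lemma radial_of_le {v : X} {r : ℝ} (h : ‖v‖ ≤ r) : radial v r = v := if_pos h

lemma radial_of_lt {v : X} {r : ℝ} (h : r < ‖v‖) : radial v r = (r / ‖v‖) • v :=
  if_neg h.not_ge

lemma radial_eq_smul (v : X) {r : ℝ} (hr : 0 ≤ r) :
    ∃ c : ℝ, 0 ≤ c ∧ c ≤ 1 ∧ radial v r = c • v := by
  rcases le_or_gt ‖v‖ r with h | h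
  · exact ⟨1, zero_le_one, le_rfl, by rw [radial_of_le h, one_smul]⟩
  · exact ⟨r / ‖v‖, by positivity, div_le_one_of_le₀ h.le (norm_nonneg v), radial_of_lt h⟩

lemma radial_norm_smul (v : X) {c : ℝ} (h0 : 0 ≤ c) (h1 : c ≤ 1) :
    radial v ‖c • v‖ = c • v := by
  have hn : ‖c • v‖ = c * ‖v‖ := by rw [norm_smul, Real.norm_of_nonneg h0]
  rcases le_or_gt ‖v‖ ‖c • v‖ with h | h
  · rw [radial_of_le h]
    have hz : (1 - c) * ‖v‖ = 0 := by
      have := mul_nonneg (sub_nonneg.2 h1) (norm_nonneg v)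
      linarith
    rcases mul_eq_zero.1 hz with hc | hv
    · rw [show c = 1 by linarith, one_smul]
    · simp [norm_eq_zero.1 hv]
  · have hv : 0 < ‖v‖ := (norm_nonneg _).trans_lt h
    rw [radial_of_lt h, hn, mul_div_assoc, div_self hv.ne', mul_one]

lemma norm_sub_radial_of_le (v : X) {r : ℝ} (hr : 0 ≤ r) (h : r ≤ ‖v‖) :
    ‖v - radial v r‖ = ‖v‖ - r := by
  rcases h.eq_or_lt with rfl | h
  · simp [radial_of_le le_rfl]
  · have hv : 0 < ‖v‖ := hr.trans_lt h
    have hc : 0 ≤ 1 - r / ‖v‖ := sub_nonneg.2 (div_le_one_of_le₀ h.le hv.le)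
    rw [radial_of_lt h]
    nth_rewrite 1 [← one_smul ℝ v]
    rw [← sub_smul, norm_smul, Real.norm_of_nonneg hc, sub_mul, one_mul,
      div_mul_cancel₀ _ hv.ne']

lemma norm_sub_radial_le (v : X) {r : ℝ} (hr : 0 ≤ r) {e : ℝ} (he : 0 ≤ e)
    (h : ‖v‖ - e ≤ r) : ‖v - radial v r‖ ≤ e := by
  rcases le_total ‖v‖ r with h' | h'
  · simpa [radial_of_le h'] using he
  · rw [norm_sub_radial_of_le v hr h']
    linarith

/-- The complement of the radial retraction is nonexpansive. -/
lemma norm_sub_radial_sub_le (u v : X) {r : ℝ} (hr : 0 ≤ r) :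
    ‖(u - radial u r) - (v - radial v r)‖ ≤ ‖u - v‖ := by
  wlog huv : ‖v‖ ≤ ‖u‖ generalizing u v
  · rw [norm_sub_rev, norm_sub_rev u v]
    exact this v u (le_of_not_ge huv)
  have hd : ‖u‖ - ‖v‖ ≤ ‖u - v‖ := norm_sub_norm_le u v
  rcases le_or_gt ‖v‖ r with hv | hv
  · rw [radial_of_le hv, sub_self, sub_zero]
    exact norm_sub_radial_le u hr (norm_nonneg _) (by linarith)
  · have hv0 : 0 < ‖v‖ := hr.trans_lt hv
    have hu0 : 0 < ‖u‖ := hv0.trans_le huv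
    have hθ0 : 0 ≤ r / ‖v‖ := by positivity
    have hθ1 : r / ‖v‖ ≤ 1 := div_le_one_of_le₀ hv.le hv0.le
    have hφ : r / ‖u‖ ≤ r / ‖v‖ := div_le_div_of_nonneg_left hr hv0 huv
    have hφu : r / ‖u‖ * ‖u‖ = r := div_mul_cancel₀ _ hu0.ne'
    have hθv : r / ‖v‖ * ‖v‖ = r := div_mul_cancel₀ _ hv0.ne'
    rw [radial_of_lt hv, radial_of_lt (hv.trans_le huv)]
    calc _ = ‖(1 - r / ‖v‖) • (u - v) + (r / ‖v‖ - r / ‖u‖) • u‖ := by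
          congr 1
          module
      _ ≤ (1 - r / ‖v‖) * ‖u - v‖ + (r / ‖v‖ - r / ‖u‖) * ‖u‖ := by
          refine (norm_add_le _ _).trans_eq ?_
          rw [norm_smul, norm_smul, Real.norm_of_nonneg (sub_nonneg.2 hθ1),
            Real.norm_of_nonneg (sub_nonneg.2 hφ)]
      _ ≤ ‖u - v‖ := by
          have := mul_le_mul_of_nonneg_left hd hθ0
          linarith

lemma RectBound.norm_smul_sub_add_le {μ : ℝ} (hrect : RectBound X μ) {u a : X} (hu : ‖u‖ = 1)
    {R : ℝ} (haR : ‖a‖ ≤ R) :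
    ‖‖a‖ • u - a‖ + (R - ‖a‖) ≤ μ * ‖R • u - a‖ := by
  obtain ⟨φ, hφ, hφu⟩ := exists_dual_vector ℝ u (norm_ne_zero_iff.1 (by simp [hu]))
  have hφu1 : φ u = 1 := by simpa [hu] using hφu
  have hle : ∀ w, |φ w| ≤ ‖w‖ := fun w => by simpa [hφ] using φ.le_opNorm w
  have hφa : φ a ≤ ‖a‖ := (le_abs_self _).trans (hle a)
  have horth : BJOrth ((R - φ a) • u) (φ a • u - a) := fun l => by
    refine le_trans (le_of_eq ?_) (hle _)
    simp [norm_smul, hu, hφu1]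
  have h := hrect _ _ horth
  rw [norm_smul, hu, mul_one, Real.norm_of_nonneg (by linarith),
    show (R - φ a) • u + (φ a • u - a) = R • u - a by module] at h
  have h2 : ‖‖a‖ • u - a‖ ≤ (‖a‖ - φ a) + ‖φ a • u - a‖ := by
    calc _ = ‖(‖a‖ - φ a) • u + (φ a • u - a)‖ := by
          congr 1
          module
      _ ≤ _ := by
          refine (norm_add_le _ _).trans_eq ?_
          rw [norm_smul, hu, mul_one, Real.norm_of_nonneg (by linarith)]
  linarith

/-- Moving the tip of a ray from `a` to `b` while keeping the distance `‖c • a‖` to the base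
point: the movement plus the new distance to the tip. -/
lemma norm_radial_sub_smul_add_le {μ : ℝ} (hμ : 1 ≤ μ) (hrect : RectBound X μ)
    (hlip : RadialLipBound X μ) (a b : X) {c : ℝ} (h0 : 0 ≤ c) (h1 : c ≤ 1) :
    ‖radial b ‖c • a‖ - c • a‖ + ‖b - radial b ‖c • a‖‖ ≤ ‖a - c • a‖ + μ * ‖b - a‖ := by
  have hra : radial a ‖c • a‖ = c • a := radial_norm_smul a h0 h1
  have hle : ‖c • a‖ ≤ ‖a‖ := by
    rw [norm_smul, Real.norm_of_nonneg h0]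
    exact mul_le_of_le_one_left (norm_nonneg a) h1
  have hxa : ‖a - c • a‖ = ‖a‖ - ‖c • a‖ := by
    rw [← norm_sub_radial_of_le a (norm_nonneg _) hle, hra]
  have hμd : ‖b - a‖ ≤ μ * ‖b - a‖ := le_mul_of_one_le_left (norm_nonneg _) hμ
  rcases le_or_gt ‖b‖ ‖c • a‖ with hb | hb
  · rw [radial_of_le hb, sub_self, norm_zero, add_zero]
    have := norm_sub_le_norm_sub_add_norm_sub b a (c • a)
    linarith
  rw [norm_sub_radial_of_le b (norm_nonneg _) hb.le, hxa]
  rcases (norm_nonneg (c • a)).eq_or_lt with hr | hr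
  · have hca : c • a = 0 := norm_eq_zero.1 hr.symm
    have hbr : radial b 0 = 0 := by simpa using radial_norm_smul b (le_refl (0 : ℝ)) zero_le_one
    have := norm_sub_norm_le b a
    rw [hca, norm_zero, hbr, sub_zero, norm_zero]
    linarith
  rcases le_total ‖b‖ ‖a‖ with hba | hba
  · have := hlip b a ‖c • a‖ hr
    rw [hra] at this
    linarith
  · have hb0 : 0 < ‖b‖ := hr.trans hb
    have hu : ‖(‖b‖⁻¹ : ℝ) • b‖ = 1 := by
      rw [norm_smul, norm_inv, norm_norm, inv_mul_cancel₀ hb0.ne']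
    have h := hrect.norm_smul_sub_add_le hu hba
    rw [smul_inv_smul₀ hb0.ne'] at h
    have hca : ‖c • a‖ = c * ‖a‖ := by rw [norm_smul, Real.norm_of_nonneg h0]
    have hmv : ‖radial b ‖c • a‖ - c • a‖ ≤ ‖‖a‖ • (‖b‖⁻¹ : ℝ) • b - a‖ := by
      rw [radial_of_lt hb, hca]
      calc _ = ‖c • (‖a‖ • (‖b‖⁻¹ : ℝ) • b - a)‖ := by
            rw [smul_sub, smul_smul, smul_smul, div_eq_mul_inv, mul_assoc]
        _ ≤ _ := by
            rw [norm_smul, Real.norm_of_nonneg h0]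
            exact mul_le_of_le_one_left (norm_nonneg _) h1
    linarith

lemma interp_step_movement {μ : ℝ} (hμ : 1 ≤ μ) (hrect : RectBound X μ)
    (hlip : RadialLipBound X μ) {p q a b x y z : X} {c e : ℝ} (h0 : 0 ≤ c) (h1 : c ≤ 1)
    (he : 0 ≤ e) (hx : x - p = c • (a - p)) (hy : y = p + radial (b - p) ‖x - p‖)
    (hz : z = p + radial (y - p) (max (‖y - p‖ - e) 0)) :
    ‖q + radial (b - q) ‖z - p‖ - x‖ + ‖b - (q + radial (b - q) ‖z - p‖)‖
      ≤ ‖a - x‖ + μ * ‖b - a‖ + 2 * e + 2 * ‖q - p‖ := by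
  have hyp : y - p = radial (b - p) ‖x - p‖ := by rw [hy, add_sub_cancel_left]
  have hzp : z - p = radial (y - p) (max (‖y - p‖ - e) 0) := by rw [hz, add_sub_cancel_left]
  obtain ⟨c₁, h10, h11, hc₁⟩ := radial_eq_smul (b - p) (norm_nonneg (x - p))
  obtain ⟨c₂, h20, h21, hc₂⟩ := radial_eq_smul (y - p) (le_max_right (‖y - p‖ - e) 0)
  have hzr : radial (b - p) ‖z - p‖ = z - p := by
    have : z - p = (c₂ * c₁) • (b - p) := by rw [hzp, hc₂, hyp, hc₁, smul_smul]
    rw [this]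
    exact radial_norm_smul _ (mul_nonneg h20 h10) (mul_le_one₀ h21 h10 h11)
  have hyz : ‖y - z‖ ≤ e := by
    rw [← sub_sub_sub_cancel_right y z p, hzp]
    exact norm_sub_radial_le _ (le_max_right _ _) he (le_max_left _ _)
  have hmove := norm_radial_sub_smul_add_le hμ hrect hlip (a - p) (b - p) h0 h1
  rw [← hx, ← hyp] at hmove
  simp only [sub_sub_sub_cancel_right] at hmove
  have hzx : ‖q + radial (b - q) ‖z - p‖ - z‖ ≤ ‖q - p‖ := by
    have h := norm_sub_radial_sub_le (b - p) (b - q) (norm_nonneg (z - p))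
    rw [hzr] at h
    convert h using 2 <;> abel
  set w := q + radial (b - q) ‖z - p‖
  have t1 := norm_sub_le_norm_sub_add_norm_sub w z x
  have t2 := norm_sub_le_norm_sub_add_norm_sub z y x
  have t3 := norm_sub_le_norm_sub_add_norm_sub b y w
  have t4 := norm_sub_le_norm_sub_add_norm_sub y z w
  rw [norm_sub_rev z y] at t2
  rw [norm_sub_rev z w] at t4
  linarith

end Radial

lemma cost_succ {X : Type*} [NormedAddCommGroup X] (f : ℕ → X → ℝ) (z : ℕ → X) (n : ℕ) :
    cost f z 1 (n + 1) = cost f z 1 n + (f (n + 1) (z (n + 1)) + ‖z (n + 1) - z n‖) := by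
  simp [cost, Finset.sum_Icc_succ_top]

/-- **Consistency of Interp.** Given convex nonnegative hitting costs
`f_1, …, f_T`, an advice sequence `adv`, a robust sequence `s` (both starting at `x₀`),
parameters `γ, δ > 0` with `ε = 2γ + 2δ`, and `μ ≥ 1` a simultaneous rectangular and
radial Lipschitz bound for `X`, the Interp sequence `x` satisfies
`C_x(1, T) ≤ (μ + ε)·C_adv(1, T)`. -/
theorem interp_consistency
    {X : Type*} [NormedAddCommGroup X] [NormedSpace ℝ X]
    (T : ℕ) (hT : 1 ≤ T) (x₀ : X) (f : ℕ → X → ℝ)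
    (hconv : ∀ t ∈ Finset.Icc 1 T, ConvexOn ℝ Set.univ (f t))
    (hnn : ∀ t ∈ Finset.Icc 1 T, ∀ p : X, 0 ≤ f t p)
    (adv s x : ℕ → X)
    (hadv0 : adv 0 = x₀) (hs0 : s 0 = x₀) (hx0 : x 0 = x₀)
    (γ δ ε μ : ℝ) (hγ : 0 < γ) (hδ : 0 < δ) (hε : ε = 2 * γ + 2 * δ)
    (hμ1 : 1 ≤ μ) (hrect : RectBound X μ) (hlip : RadialLipBound X μ)
    (hstep : ∀ t ∈ Finset.Icc 1 T,
      x t =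
        if δ * cost f adv 1 t ≤ cost f s 1 t then adv t
        else
          let Δ := f t (adv t) + ‖adv t - adv (t - 1)‖
          let y := s (t - 1) + radial (adv t - s (t - 1)) ‖x (t - 1) - s (t - 1)‖
          let z := s (t - 1) +
            radial (y - s (t - 1)) (max (‖y - s (t - 1)‖ - γ * Δ) 0)
          s t + radial (adv t - s t) ‖z - s (t - 1)‖) :
    cost f x 1 T ≤ (μ + ε) * cost f adv 1 T := by
  have key : ∀ n ≤ T, (∃ c : ℝ, 0 ≤ c ∧ c ≤ 1 ∧ x n - s n = c • (adv n - s n)) ∧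
      cost f x 1 n + ‖adv n - x n‖ ≤
        (μ + 2 * γ) * cost f adv 1 n + 2 * min (cost f s 1 n) (δ * cost f adv 1 n) := by
    intro n
    induction n with
    | zero =>
      intro _
      exact ⟨⟨0, le_rfl, zero_le_one, by simp [hx0, hs0]⟩, by simp [cost, hx0, hadv0]⟩
    | succ n ih =>
      intro hn
      obtain ⟨⟨c, hc0, hc1, hc⟩, ih⟩ := ih (by omega)
      have hmem : n + 1 ∈ Finset.Icc 1 T := Finset.mem_Icc.2 ⟨by omega, hn⟩
      have hxn := hstep (n + 1) hmem
      have hfa := hnn _ hmem (adv (n + 1))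
      have hfs := hnn _ hmem (s (n + 1))
      have hda := norm_nonneg (adv (n + 1) - adv n)
      have hds := norm_nonneg (s (n + 1) - s n)
      have hμf := mul_nonneg (sub_nonneg.2 hμ1) hfa
      have hμd := mul_nonneg (sub_nonneg.2 hμ1) hda
      have hγf := mul_nonneg hγ.le hfa
      have hγd := mul_nonneg hγ.le hda
      simp only [add_tsub_cancel_right] at hxn
      split_ifs at hxn with hif
      · refine ⟨⟨1, zero_le_one, le_rfl, by rw [hxn, one_smul]⟩, ?_⟩
        have hmin : min (cost f s 1 n) (δ * cost f adv 1 n) ≤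
            min (cost f s 1 (n + 1)) (δ * cost f adv 1 (n + 1)) := by
          rw [cost_succ, cost_succ]
          gcongr
          · linarith
          · linarith
        have htri := norm_sub_le_norm_sub_add_norm_sub (adv (n + 1)) (adv n) (x n)
        rw [cost_succ f x, cost_succ f adv, hxn, sub_self, norm_zero]
        rw [cost_succ f adv] at hmin
        linarith
      · set Δ := f (n + 1) (adv (n + 1)) + ‖adv (n + 1) - adv n‖ with hΔ
        have hstepn := interp_step_movement (q := s (n + 1)) (b := adv (n + 1))
          hμ1 hrect hlip hc0 hc1 (mul_nonneg hγ.le (add_nonneg hfa hda)) hc rfl rfl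
        rw [← hΔ, ← hxn] at hstepn
        obtain ⟨d, hd0, hd1, hd⟩ := radial_eq_smul (adv (n + 1) - s (n + 1))
          (norm_nonneg (s n + radial (s n + radial (adv (n + 1) - s n) ‖x n - s n‖ - s n)
            (max (‖s n + radial (adv (n + 1) - s n) ‖x n - s n‖ - s n‖ - γ * Δ) 0) - s n))
        rw [hd] at hxn
        refine ⟨⟨d, hd0, hd1, by rw [hxn, add_sub_cancel_left]⟩, ?_⟩
        have hfx : f (n + 1) (x (n + 1)) ≤ f (n + 1) (adv (n + 1)) + f (n + 1) (s (n + 1)) := by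
          have h := (hconv _ hmem).2 (Set.mem_univ (adv (n + 1))) (Set.mem_univ (s (n + 1)))
            hd0 (sub_nonneg.2 hd1) (by ring)
          rw [show d • adv (n + 1) + (1 - d) • s (n + 1) = x (n + 1) by rw [hxn]; module] at h
          simp only [smul_eq_mul] at h
          have := mul_nonneg (sub_nonneg.2 hd1) hfa
          have := mul_nonneg hd0 hfs
          linarith
        rw [min_eq_left (le_of_not_ge hif)]
        have hmin := min_le_left (cost f s 1 n) (δ * cost f adv 1 n)
        rw [cost_succ f x, cost_succ f adv, cost_succ f s]
        simp only [hΔ] at hstepn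
        linarith
  have hT' := (key T le_rfl).2
  have hmin := min_le_right (cost f s 1 T) (δ * cost f adv 1 T)
  have hd := norm_nonneg (adv T - x T)
  rw [hε]
  linarith
end

section
/- (Competitiveness of Switch with respect to the robust algorithm.) Let X be a real normed vector space, T a positive integer, x_0 ∈ X, and f_1, …, f_T : X → ℝ convex functions with f_t ≥ 0 everywhere. Let Adv_0 = Rob_0 = x_0 and let Adv_1, …, Adv_T and Rob_1, …, Rob_T be sequences in X with C_Rob(1, T) ≥ 1. Let b > 1 and δ ∈ (0, 1], and let x_1, …, x_T be the Switch sequence determined by these data. Then C_x(1, T) ≤ (1 + 2·(b² + b³/δ)/(b² − 1))·C_Rob(1, T). -/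
open scoped Classical

/-- `ell f Adv Rob T b δ i` is the largest `t ∈ {1, …, T}` with `C_Adv(1, t) ≤ b^i`
when `i` is even, respectively `C_Rob(1, t) ≤ δ·b^i` when `i` is odd (and `0` if no
such `t` exists). -/
noncomputable def ell {X : Type*} [NormedAddCommGroup X]
    (f : ℕ → X → ℝ) (Adv Rob : ℕ → X) (T : ℕ) (b δ : ℝ) (i : ℕ) : ℕ :=
  if Even i then
    ((Finset.Icc 1 T).filter fun t => cost f Adv 1 t ≤ b ^ i).sup id
  else
    ((Finset.Icc 1 T).filter fun t => cost f Rob 1 t ≤ δ * b ^ i).sup id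

/-- `mSeq … i` is `m_{i−1}` of the Switch phase construction: `m_{−1} = 0` and
`m_i = max(m_{i−1}, ℓ_i)`, so that phase `i` consists of the times
`mSeq … i < t ≤ mSeq … (i+1)`. -/
noncomputable def mSeq {X : Type*} [NormedAddCommGroup X]
    (f : ℕ → X → ℝ) (Adv Rob : ℕ → X) (T : ℕ) (b δ : ℝ) : ℕ → ℕ
  | 0 => 0
  | i + 1 => max (mSeq f Adv Rob T b δ i) (ell f Adv Rob T b δ i)

section Cost

variable {X : Type*} [NormedAddCommGroup X]

lemma cost_one_zero (f : ℕ → X → ℝ) (z : ℕ → X) : cost f z 1 0 = 0 := by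
  simp [cost]

lemma cost_one_succ (f : ℕ → X → ℝ) (z : ℕ → X) (t : ℕ) :
    cost f z 1 (t + 1) = cost f z 1 t + (f (t + 1) (z (t + 1)) + ‖z (t + 1) - z t‖) := by
  simp [cost, Finset.sum_Icc_succ_top]

lemma norm_sub_zero_le_cost {f : ℕ → X → ℝ} {T : ℕ}
    (hnn : ∀ t ∈ Finset.Icc 1 T, ∀ p : X, 0 ≤ f t p) (z : ℕ → X) {t : ℕ} (ht : t ≤ T) :
    ‖z t - z 0‖ ≤ cost f z 1 t := by
  induction t with
  | zero => simp [cost_one_zero]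
  | succ t ih =>
    have h₁ := ih (by omega)
    have h₂ := hnn (t + 1) (by simp; omega) (z (t + 1))
    have h₃ := norm_sub_le_norm_sub_add_norm_sub (z (t + 1)) (z t) (z 0)
    rw [cost_one_succ]
    linarith

/-- The cost of a sequence that follows `z` after time `m` exceeds that of `z` by at most the
distance between the two sequences at time `m`. -/
lemma cost_add_norm_sub_le_of_eqOn (f : ℕ → X → ℝ) {x z : ℕ → X} {m n : ℕ} (hmn : m ≤ n)
    (h : ∀ t, m < t → t ≤ n → x t = z t) :
    cost f x 1 n + ‖x n - z n‖ ≤ cost f x 1 m + ‖x m - z m‖ + (cost f z 1 n - cost f z 1 m) := by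
  induction n, hmn using Nat.le_induction with
  | base => simp
  | succ n hmn ih =>
    have h₁ := ih fun t ht ht' => h t ht (by omega)
    have h₂ : x (n + 1) = z (n + 1) := h _ (by omega) le_rfl
    have h₃ := norm_sub_le_norm_sub_add_norm_sub (z (n + 1)) (z n) (x n)
    rw [norm_sub_rev (z n) (x n)] at h₃
    rw [cost_one_succ, cost_one_succ, h₂, sub_self, norm_zero]
    linarith

/-- Following `z` from time `m` to time `n` costs at most a detour through the common starting
point plus the cost of `z`. -/
lemma cost_le_of_eqOn {f : ℕ → X → ℝ} {T : ℕ}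
    (hnn : ∀ t ∈ Finset.Icc 1 T, ∀ p : X, 0 ≤ f t p) {x z : ℕ → X} (h₀ : z 0 = x 0) {m n : ℕ}
    (hmn : m ≤ n) (hn : n ≤ T) (h : ∀ t, m < t → t ≤ n → x t = z t) :
    cost f x 1 n ≤ cost f x 1 m + ‖x m - x 0‖ + cost f z 1 n := by
  have h₁ := cost_add_norm_sub_le_of_eqOn f hmn h
  have h₂ := norm_sub_zero_le_cost hnn z (hmn.trans hn)
  have h₃ := norm_sub_le_norm_sub_add_norm_sub (x m) (x 0) (z m)
  rw [norm_sub_rev (x 0) (z m), ← h₀] at h₃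
  rw [← h₀]
  linarith [norm_nonneg (x n - z n)]

end Cost

/-- The algorithm followed by Switch in phase `i`. -/
def followed {X : Type*} (Adv Rob : ℕ → X) (i : ℕ) : ℕ → X :=
  if Even i then Adv else Rob

/-- The cost threshold of phase `i`. -/
noncomputable def threshold (b δ : ℝ) (i : ℕ) : ℝ :=
  if Even i then b ^ i else δ * b ^ i

lemma threshold_nonneg {b δ : ℝ} (hb : 0 ≤ b) (hδ : 0 ≤ δ) (i : ℕ) : 0 ≤ threshold b δ i := by
  unfold threshold
  split_ifs <;> positivity

lemma sum_range_threshold (b δ : ℝ) (p : ℕ) :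
    (b ^ 2 - 1) * ∑ k ∈ Finset.range (2 * p + 1), threshold b δ k =
      b ^ (2 * p + 2) - 1 + δ * (b ^ (2 * p + 1) - b) := by
  induction p with
  | zero => simp [threshold]
  | succ p ih =>
    have h₁ : threshold b δ (2 * p + 1) = δ * b ^ (2 * p + 1) := by simp [threshold]
    have h₂ : threshold b δ (2 * p + 1 + 1) = b ^ (2 * p + 2) := by
      simp [threshold, Nat.even_add_one]
    rw [show 2 * (p + 1) + 1 = 2 * p + 1 + 1 + 1 by ring, Finset.sum_range_succ,
      Finset.sum_range_succ, h₁, h₂, mul_add, mul_add, ih]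
    ring

lemma sum_range_threshold_le {b δ R : ℝ} (hb : 1 < b) (hδ0 : 0 < δ) (hδ1 : δ ≤ 1) (hR : 1 ≤ R)
    {p : ℕ} (hp : ∀ q, q < p → δ * b ^ (2 * q + 1) ≤ R) :
    2 * ∑ k ∈ Finset.range (2 * p + 1), threshold b δ k ≤
      2 * (b ^ 2 + b ^ 3 / δ) / (b ^ 2 - 1) * R := by
  have hb2 : 0 < b ^ 2 - 1 := by nlinarith
  have key : δ * b ^ (2 * p + 1) ≤ b ^ 2 * R := by
    cases p with
    | zero =>
      have h₁ : δ * b ≤ b ^ 2 := by nlinarith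
      have h₂ : b ^ 2 ≤ b ^ 2 * R := le_mul_of_one_le_right (by positivity) hR
      simpa using h₁.trans h₂
    | succ q =>
      have h₁ := mul_le_mul_of_nonneg_left (hp q (by omega)) (sq_nonneg b)
      calc δ * b ^ (2 * (q + 1) + 1) = b ^ 2 * (δ * b ^ (2 * q + 1)) := by ring
        _ ≤ b ^ 2 * R := h₁
  have key' : b ^ (2 * p + 2) ≤ b ^ 3 / δ * R := by
    rw [div_mul_eq_mul_div, le_div_iff₀ hδ0]
    have h₁ := mul_le_mul_of_nonneg_left key (zero_le_one.trans hb.le)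
    calc b ^ (2 * p + 2) * δ = b * (δ * b ^ (2 * p + 1)) := by ring
      _ ≤ b * (b ^ 2 * R) := h₁
      _ = b ^ 3 * R := by ring
  rw [div_mul_eq_mul_div, le_div_iff₀ hb2]
  have h₁ := sum_range_threshold b δ p
  have h₂ : 0 < δ * b := by positivity
  linarith

section Switch

variable {X : Type*} [NormedAddCommGroup X] {f : ℕ → X → ℝ} {Adv Rob : ℕ → X} {T : ℕ} {b δ : ℝ}

lemma ell_eq_sup (i : ℕ) :
    ell f Adv Rob T b δ i = ((Finset.Icc 1 T).filter fun t =>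
      cost f (followed Adv Rob i) 1 t ≤ threshold b δ i).sup id := by
  unfold ell followed threshold
  split_ifs <;> rfl

lemma ell_le (i : ℕ) : ell f Adv Rob T b δ i ≤ T := by
  rw [ell_eq_sup]
  refine Finset.sup_le fun t ht => ?_
  simp only [Finset.mem_filter, Finset.mem_Icc] at ht
  exact ht.1.2

lemma le_ell {i t : ℕ} (ht : t ∈ Finset.Icc 1 T)
    (h : cost f (followed Adv Rob i) 1 t ≤ threshold b δ i) : t ≤ ell f Adv Rob T b δ i := by
  rw [ell_eq_sup]
  exact Finset.le_sup (f := id) (Finset.mem_filter.2 ⟨ht, h⟩)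

lemma cost_ell_le {i : ℕ} (h : 0 < ell f Adv Rob T b δ i) :
    cost f (followed Adv Rob i) 1 (ell f Adv Rob T b δ i) ≤ threshold b δ i := by
  rw [ell_eq_sup] at h ⊢
  set s := (Finset.Icc 1 T).filter fun t =>
    cost f (followed Adv Rob i) 1 t ≤ threshold b δ i
  have hne : s.Nonempty := by
    by_contra hne
    simp [Finset.not_nonempty_iff_eq_empty.1 hne] at h
  obtain ⟨t, ht, hts⟩ := Finset.exists_mem_eq_sup s hne id
  rw [hts]
  exact (Finset.mem_filter.1 ht).2

lemma mSeq_le (i : ℕ) : mSeq f Adv Rob T b δ i ≤ T := by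
  induction i with
  | zero => simp [mSeq]
  | succ i ih => exact max_le ih (ell_le i)

lemma mSeq_le_succ (i : ℕ) : mSeq f Adv Rob T b δ i ≤ mSeq f Adv Rob T b δ (i + 1) :=
  le_max_left _ _

lemma mSeq_mono : Monotone (mSeq f Adv Rob T b δ) :=
  monotone_nat_of_le_succ mSeq_le_succ

lemma le_mSeq_succ_of_cost_le {i : ℕ} (hT : 1 ≤ T)
    (h : cost f (followed Adv Rob i) 1 T ≤ threshold b δ i) :
    T ≤ mSeq f Adv Rob T b δ (i + 1) :=
  (le_ell (by simp [hT]) h).trans (le_max_right _ _)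

lemma cost_mSeq_succ_le {i : ℕ} (h : mSeq f Adv Rob T b δ i < mSeq f Adv Rob T b δ (i + 1)) :
    cost f (followed Adv Rob i) 1 (mSeq f Adv Rob T b δ (i + 1)) ≤ threshold b δ i := by
  have hlt : mSeq f Adv Rob T b δ i < ell f Adv Rob T b δ i := by
    simpa [mSeq] using h
  rw [mSeq, max_eq_right hlt.le]
  exact cost_ell_le (by omega)

lemma exists_le_mSeq (hT : 1 ≤ T) (hb : 1 < b) (hδ0 : 0 < δ) :
    ∃ i, T ≤ mSeq f Adv Rob T b δ i := by
  obtain ⟨n, hn⟩ := pow_unbounded_of_one_lt (cost f Rob 1 T / δ) hb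
  have hodd : ¬ Even (2 * n + 1) := by simp
  refine ⟨2 * n + 1 + 1, le_mSeq_succ_of_cost_le hT ?_⟩
  rw [followed, threshold, if_neg hodd, if_neg hodd, mul_comm, ← div_le_iff₀ hδ0]
  exact hn.le.trans (pow_le_pow_right₀ hb.le (by omega))

/-- At the end of each phase, the cost of Switch together with its distance from the starting
point is at most twice the sum of the thresholds so far. -/
lemma cost_mSeq_add_norm_le (hnn : ∀ t ∈ Finset.Icc 1 T, ∀ p : X, 0 ≤ f t p) {x : ℕ → X}
    (h₀ : ∀ i, followed Adv Rob i 0 = x 0) (hb : 0 ≤ b) (hδ : 0 ≤ δ)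
    (hx : ∀ i t, mSeq f Adv Rob T b δ i < t → t ≤ mSeq f Adv Rob T b δ (i + 1) →
      x t = followed Adv Rob i t) (i : ℕ) :
    cost f x 1 (mSeq f Adv Rob T b δ i) + ‖x (mSeq f Adv Rob T b δ i) - x 0‖ ≤
      2 * ∑ k ∈ Finset.range i, threshold b δ k := by
  induction i with
  | zero => simp [mSeq, cost_one_zero]
  | succ i ih =>
    rw [Finset.sum_range_succ]
    rcases (mSeq_le_succ (f := f) (Adv := Adv) (Rob := Rob) (T := T) (b := b) (δ := δ)
      i).eq_or_lt with h | h
    · rw [← h]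
      linarith [threshold_nonneg hb hδ i]
    · have h₁ := cost_le_of_eqOn hnn (h₀ i) h.le (mSeq_le _) (hx i)
      have h₂ := norm_sub_zero_le_cost hnn (followed Adv Rob i)
        (mSeq_le (f := f) (Adv := Adv) (Rob := Rob) (T := T) (b := b) (δ := δ) (i + 1))
      have h₃ := cost_mSeq_succ_le h
      rw [h₀ i, ← hx i _ h le_rfl] at h₂
      linarith

end Switch

/-- **Competitiveness of Switch w.r.t. the robust algorithm.** With convex
nonnegative hitting costs, sequences `Adv`, `Rob` starting at `x₀` with
`C_Rob(1, T) ≥ 1`, parameters `b > 1`, `δ ∈ (0, 1]`, the Switch sequence `x`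
(following `Adv` during even phases and `Rob` during odd phases) satisfies
`C_x(1, T) ≤ (1 + 2(b² + b³/δ)/(b² − 1))·C_Rob(1, T)`. -/
theorem switch_robustness
    {X : Type*} [NormedAddCommGroup X] [NormedSpace ℝ X]
    (T : ℕ) (hT : 1 ≤ T) (x₀ : X) (f : ℕ → X → ℝ)
    (hconv : ∀ t ∈ Finset.Icc 1 T, ConvexOn ℝ Set.univ (f t))
    (hnn : ∀ t ∈ Finset.Icc 1 T, ∀ p : X, 0 ≤ f t p)
    (Adv Rob x : ℕ → X)
    (hAdv0 : Adv 0 = x₀) (hRob0 : Rob 0 = x₀) (hx0 : x 0 = x₀)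
    (hRob1 : 1 ≤ cost f Rob 1 T)
    (b δ : ℝ) (hb : 1 < b) (hδ0 : 0 < δ) (hδ1 : δ ≤ 1)
    (hstep : ∀ t ∈ Finset.Icc 1 T, ∀ i : ℕ,
      mSeq f Adv Rob T b δ i < t → t ≤ mSeq f Adv Rob T b δ (i + 1) →
      x t = if Even i then Adv t else Rob t) :
    cost f x 1 T ≤ (1 + 2 * (b ^ 2 + b ^ 3 / δ) / (b ^ 2 - 1)) * cost f Rob 1 T := by
  have h₀ : ∀ i, followed Adv Rob i 0 = x 0 := fun i => by
    unfold followed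
    split_ifs <;> simp [hAdv0, hRob0, hx0]
  have hx : ∀ i t, mSeq f Adv Rob T b δ i < t → t ≤ mSeq f Adv Rob T b δ (i + 1) →
      x t = followed Adv Rob i t := fun i t h h' => by
    rw [hstep t (Finset.mem_Icc.2 ⟨by omega, h'.trans (mSeq_le _)⟩) i h h', followed]
    split_ifs <;> rfl
  have hb0 : 0 ≤ b := zero_le_one.trans hb.le
  -- `n` is the phase that reaches the time horizon.
  obtain ⟨n, hn, hTn⟩ : ∃ n, mSeq f Adv Rob T b δ n < T ∧ mSeq f Adv Rob T b δ (n + 1) = T := by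
    have hex := exists_le_mSeq (f := f) (Adv := Adv) (Rob := Rob) hT hb hδ0
    obtain ⟨n, hn⟩ := Nat.exists_eq_succ_of_ne_zero (n := Nat.find hex) fun h => by
      have := Nat.find_spec hex
      rw [h, mSeq] at this
      omega
    refine ⟨n, not_le.1 (Nat.find_min hex (by omega)), (mSeq_le _).antisymm ?_⟩
    have := Nat.find_spec hex
    rwa [hn] at this
  have hodd : ∀ q, 2 * q + 1 < n → δ * b ^ (2 * q + 1) ≤ cost f Rob 1 T := fun q hq => by
    by_contra! hlt
    have := le_mSeq_succ_of_cost_le (f := f) (Adv := Adv) (Rob := Rob) (b := b) (δ := δ)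
      (i := 2 * q + 1) hT (by simpa [followed, threshold] using hlt.le)
    have := mSeq_mono (f := f) (Adv := Adv) (Rob := Rob) (T := T) (b := b) (δ := δ)
      (show 2 * q + 1 + 1 ≤ n by omega)
    omega
  have h₁ := cost_mSeq_add_norm_le hnn h₀ hb0 hδ0.le hx n
  have h₂ := cost_le_of_eqOn hnn (h₀ n) (mSeq_le_succ n) (mSeq_le _) (hx n)
  have h₃ := cost_mSeq_succ_le (hn.trans_eq hTn.symm)
  rw [hTn] at h₂ h₃
  rw [add_mul, one_mul]
  obtain ⟨p, rfl | rfl⟩ := n.even_or_odd'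
  · have h₄ := sum_range_threshold_le hb hδ0 hδ1 hRob1 (p := p) fun q hq => hodd q (by omega)
    have h₅ := threshold_nonneg hb0 hδ0.le (2 * p)
    rw [Finset.sum_range_succ] at h₄
    linarith
  · have h₄ := sum_range_threshold_le hb hδ0 hδ1 hRob1 (p := p) fun q hq => hodd q (by omega)
    have h₅ : followed Adv Rob (2 * p + 1) = Rob := by simp [followed]
    rw [h₅] at h₂
    linarith
end
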